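/- Let Γ be a G-set with exactly two valleys, the y-valley (i_y,j_y) and the z-valley (i_z,k_z), and write j = j(Γ), k = k(Γ). Set β = (0,j+1,0), γ = (0,0,k+1), δ_y = (i_y+1, j_y+1, 0), δ_z = (i_z+1, 0, k_z+1). Then the monoid S(Γ) is generated by the four elements s_Γ(β), s_Γ(γ), s_Γ(δ_y), s_Γ(δ_z), and moreover s_Γ(β) + s_Γ(δ_z) = s_Γ(γ) + s_Γ(δ_y) = (0,1,1). -/

import Mathlib

open scoped BigOperators Classical

namespace GH

/-- Exponent vectors of monomials `x^m y^n z^p`. -/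
abbrev N3 : Type := ℕ × ℕ × ℕ

/-- The lattice `ℤ³`. -/
abbrev Z3 : Type := ℤ × ℤ × ℤ

/-- Inclusion `ℕ³ → ℤ³`. -/
def toZ (v : N3) : Z3 := ((v.1 : ℤ), (v.2.1 : ℤ), (v.2.2 : ℤ))

/-- The weight map `wt(m,n,p) = m + a·n + (r−a)·p (mod r)` on `ℤ³`. -/
def wtZ (r a : ℕ) (v : Z3) : ZMod r :=
  (v.1 : ZMod r) + (a : ZMod r) * (v.2.1 : ZMod r) + ((r - a : ℕ) : ZMod r) * (v.2.2 : ZMod r)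

/-- The weight map on `ℕ³`. -/
def wtN (r a : ℕ) (v : N3) : ZMod r := wtZ r a (toZ v)

/-- A `G`-set: contains the origin, closed under taking summands, and the weight map
restricted to it is a bijection onto `ℤ/rℤ`. -/
structure IsGSet (r a : ℕ) (Γ : Set N3) : Prop where
  zero_mem : (0, 0, 0) ∈ Γ
  dclosed : ∀ u v : N3, u + v ∈ Γ → u ∈ Γ ∧ v ∈ Γ
  bij : Set.BijOn (wtN r a) Γ Set.univ

/-- `wt_Γ(v)`: the (unique, for a `G`-set) element of `Γ` of the same weight as `v`. -/
noncomputable def wtG (r a : ℕ) (Γ : Set N3) (v : N3) : N3 :=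
  if h : ∃ w, w ∈ Γ ∧ wtN r a w = wtN r a v then h.choose else (0, 0, 0)

/-- `(m,n)` is a y-valley of `Γ`. -/
def IsYValley (Γ : Set N3) (m n : ℕ) : Prop :=
  (m, n, 0) ∈ Γ ∧ (m + 1, n, 0) ∈ Γ ∧ (m, n + 1, 0) ∈ Γ ∧ (m + 1, n + 1, 0) ∉ Γ

/-- `(m,n)` is a z-valley of `Γ`. -/
def IsZValley (Γ : Set N3) (m n : ℕ) : Prop :=
  (m, 0, n) ∈ Γ ∧ (m + 1, 0, n) ∈ Γ ∧ (m, 0, n + 1) ∈ Γ ∧ (m + 1, 0, n + 1) ∉ Γ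

/-- A primitive `G`-set: it has a y-valley `(i_y, 0)` and a z-valley `(i_z, 0)`. -/
def IsPrimG (Γ : Set N3) : Prop := (∃ p : ℕ, IsYValley Γ p 0) ∧ (∃ p : ℕ, IsZValley Γ p 0)

/-- `s_Γ(v) = v − wt_Γ(v) ∈ ℤ³`. -/
noncomputable def sG (r a : ℕ) (Γ : Set N3) (v : N3) : Z3 := toZ v - toZ (wtG r a Γ v)

/-- The submonoid `S(Γ)` of `ℤ³` generated by all `s_Γ(v)`. -/
noncomputable def SMon (r a : ℕ) (Γ : Set N3) : AddSubmonoid Z3 :=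
  AddSubmonoid.closure (Set.range (sG r a Γ))

/-- The lattice `M = { u ∈ ℤ³ : wt(u) = 0 }` of `G`-invariant monomials. -/
def latM (r a : ℕ) : Set Z3 := { u | wtZ r a u = 0 }

/-- The standard pairing of `ℝ³` with `ℤ³`. -/
def dotR (α : ℝ × ℝ × ℝ) (u : Z3) : ℝ :=
  α.1 * (u.1 : ℝ) + α.2.1 * (u.2.1 : ℝ) + α.2.2 * (u.2.2 : ℝ)

/-- The cone `σ(Γ) = { α ∈ ℝ³ : ⟨α, s_Γ(v)⟩ ≥ 0 for all v ∈ ℕ³ }`. -/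
noncomputable def sigmaCone (r a : ℕ) (Γ : Set N3) : Set (ℝ × ℝ × ℝ) :=
  { α | ∀ v : N3, 0 ≤ dotR α (sG r a Γ v) }

/-- `span(u₁,…,u_t)`: all `v ∈ ℕ³` dominated componentwise by some `u_s`. -/
def spanSet (s : Set N3) : Set N3 := { v | ∃ u ∈ s, v ≤ u }

/-- `i(Γ)`: the largest `m` with `(m,0,0) ∈ Γ`. -/
noncomputable def iOf (Γ : Set N3) : ℕ := sSup { m : ℕ | (m, 0, 0) ∈ Γ }

/-- `j(Γ)`: the largest `n` with `(0,n,0) ∈ Γ`. -/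
noncomputable def jOf (Γ : Set N3) : ℕ := sSup { n : ℕ | (0, n, 0) ∈ Γ }

/-- `k(Γ)`: the largest `p` with `(0,0,p) ∈ Γ`. -/
noncomputable def kOf (Γ : Set N3) : ℕ := sSup { p : ℕ | (0, 0, p) ∈ Γ }

/-- `c(w) = max { c : w − c·v ∈ ℕ³ }` (componentwise). -/
noncomputable def cmax (v w : N3) : ℕ := sSup { c : ℕ | c • v ≤ w }

/-- The `G`-igsaw transformation of `Γ` in the direction of `u`:
`T_u(Γ) = { w + c(w)·(u − v) : w ∈ Γ }` where `v = wt_Γ(u)`. -/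
noncomputable def jig (r a : ℕ) (Γ : Set N3) (u : N3) : Set N3 :=
  { w' | ∃ w ∈ Γ,
      toZ w' = toZ w + (cmax (wtG r a Γ u) w) • (toZ u - toZ (wtG r a Γ u)) }

/-- The upper transformation `TU(Γ)`. -/
noncomputable def TU (r a : ℕ) (Γ : Set N3) : Set N3 := jig r a Γ (iOf Γ + 1, 0, 0)

/-- The right transformation `TR(Γ)`. -/
noncomputable def TR (r a : ℕ) (Γ : Set N3) : Set N3 := jig r a Γ (0, jOf Γ + 1, 0)

/-- The left transformation `TL(Γ)`. -/
noncomputable def TL (r a : ℕ) (Γ : Set N3) : Set N3 := jig r a Γ (0, 0, kOf Γ + 1)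

/-- The y-valley of `Γ` (chosen by choice; unique for a `G`-set having one). -/
noncomputable def yValley (Γ : Set N3) : ℕ × ℕ :=
  if h : ∃ p : ℕ × ℕ, IsYValley Γ p.1 p.2 then h.choose else (0, 0)

/-- The z-valley of `Γ` (chosen by choice; unique for a `G`-set having one). -/
noncomputable def zValley (Γ : Set N3) : ℕ × ℕ :=
  if h : ∃ p : ℕ × ℕ, IsZValley Γ p.1 p.2 then h.choose else (0, 0)

/-- The upper right transformation `TUR(Γ)`, in the direction `(i_y+1, j_y+1, 0)`. -/
noncomputable def TUR (r a : ℕ) (Γ : Set N3) : Set N3 :=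
  jig r a Γ ((yValley Γ).1 + 1, (yValley Γ).2 + 1, 0)

/-- The upper left transformation `TUL(Γ)`, in the direction `(i_z+1, 0, k_z+1)`. -/
noncomputable def TUL (r a : ℕ) (Γ : Set N3) : Set N3 :=
  jig r a Γ ((zValley Γ).1 + 1, 0, (zValley Γ).2 + 1)

/-- The bound `min{j, k, j − j_y, k − k_z}` for the triangle of transformations. -/
noncomputable def minBound (Γ : Set N3) : ℕ :=
  min (min (jOf Γ) (kOf Γ)) (min (jOf Γ - (yValley Γ).2) (kOf Γ - (zValley Γ).2))

/-- The triangle of transformations `Θ(Γ)`. -/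
noncomputable def Theta (r a : ℕ) (Γ : Set N3) : Set (Set N3) :=
  { Γ' | ∃ p q : ℕ, p + q ≤ minBound Γ ∧ Γ' = (TUR r a)^[p] ((TUL r a)^[q] Γ) }

/-- The recursion step producing `Γ_{n+1}` from `Γ_n`. -/
noncomputable def nextGamma (r a : ℕ) (Γ : Set N3) : Set N3 :=
  if jOf Γ < kOf Γ then TU r a ((TUR r a)^[jOf Γ] Γ)
  else TU r a ((TUL r a)^[kOf Γ] Γ)

/-- The sequence of primitive `G`-sets; `GammaSeq r a b (n-1)` is `Γ_n`,
starting from `Γ₁ = span((1,0,0),(0,b−1,0),(0,0,r−b−1))`. -/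
noncomputable def GammaSeq (r a b : ℕ) : ℕ → Set N3
  | 0 => spanSet {(1, 0, 0), (0, b - 1, 0), (0, 0, r - b - 1)}
  | n + 1 => nextGamma r a (GammaSeq r a b n)


/-- A down-closed set of exponents (given as a predicate on coordinates) on which the weight
`m + b·n − b·p` is a bijection onto `ℤ/rℤ`. -/
structure IsWeightBasis (r : ℕ) (b : ZMod r) (P : ℕ → ℕ → ℕ → Prop) : Prop where
  down : ∀ {m n p m' n' p' : ℕ}, P m n p → m' ≤ m → n' ≤ n → p' ≤ p → P m' n' p'
  inj : ∀ {m n p m' n' p' : ℕ}, P m n p → P m' n' p' →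
    (m : ZMod r) + b * n - b * p = m' + b * n' - b * p' → m = m' ∧ n = n' ∧ p = p'
  surj : ∀ c : ZMod r, ∃ m n p : ℕ, P m n p ∧ (m : ZMod r) + b * n - b * p = c

/-- A corner of a planar down-closed set: `(m,n)`, `(m+1,n)`, `(m,n+1)` belong to it and
`(m+1,n+1)` does not. -/
def IsCorner (Q : ℕ → ℕ → Prop) (m n : ℕ) : Prop :=
  Q m n ∧ Q (m + 1) n ∧ Q m (n + 1) ∧ ¬ Q (m + 1) (n + 1)

/-- If `(c,d)` is the only possible corner of a planar down-closed set, then every missing point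
whose projections to both axes belong to the set lies strictly above `(c,d)`. -/
theorem corner_lt_of_notMem {Q : ℕ → ℕ → Prop}
    (hQ : ∀ {m n m' n' : ℕ}, Q m n → m' ≤ m → n' ≤ n → Q m' n') {c d : ℕ}
    (hu : ∀ m n : ℕ, IsCorner Q m n → (m, n) = (c, d)) (m n : ℕ)
    (hm : Q m 0) (hn : Q 0 n) (h : ¬ Q m n) : c < m ∧ d < n := by
  induction hs : m + n using Nat.strong_induction_on generalizing m n with
  | _ s ih =>
    obtain _ | m := m
    · exact absurd hn h
    obtain _ | n := n
    · exact absurd hm h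
    by_cases h1 : Q m (n + 1)
    · by_cases h2 : Q (m + 1) n
      · have := hu m n ⟨hQ h1 le_rfl (by omega), h2, h1, h⟩
        simp only [Prod.mk.injEq] at this
        omega
      · have := ih _ (by omega) (m + 1) n hm (hQ hn le_rfl (by omega)) h2 rfl
        omega
    · have := ih _ (by omega) m (n + 1) (hQ hm (by omega) le_rfl) hn h1 rfl
      omega

namespace IsWeightBasis

variable {r : ℕ} {b : ZMod r} {P : ℕ → ℕ → ℕ → Prop}

theorem swap (h : IsWeightBasis r b P) : IsWeightBasis r (-b) (fun m n p => P m p n) where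
  down hP hm hn hp := h.down hP hm hp hn
  inj hP hP' e := by
    have := h.inj hP hP' (by linear_combination e)
    omega
  surj c := by
    obtain ⟨m, n, p, hP, e⟩ := h.surj c
    exact ⟨m, p, n, hP, by linear_combination e⟩

theorem zero_mem (h : IsWeightBasis r b P) : P 0 0 0 := by
  obtain ⟨m, n, p, hP, -⟩ := h.surj 0
  exact h.down hP (by omega) (by omega) (by omega)

theorem notMem_of_pos_of_pos (h : IsWeightBasis r b P) {m n p : ℕ} (hn : 0 < n) (hp : 0 < p) :
    ¬ P m n p := by
  intro hP
  have h1 : P 0 1 1 := h.down hP (by omega) (by omega) (by omega)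
  have := h.inj h1 h.zero_mem (by push_cast; ring)
  omega

/-- The weight of the monomial above a z-corner is that of the largest power of `y`. -/
theorem weight_corner (h : IsWeightBasis r b P) {i k j : ℕ}
    (hc : IsCorner (fun m p => P m 0 p) i k) (hj : P 0 j 0) (hj' : ¬ P 0 (j + 1) 0) :
    (i : ZMod r) + 1 - b * (k + 1) = b * j := by
  obtain ⟨-, h1, h2, h3⟩ := hc
  obtain ⟨m, n, p, hP, e⟩ := h.surj ((i : ZMod r) + 1 - b * (k + 1))
  obtain _ | m := m
  swap
  · have := h.inj h2 (h.down hP m.le_succ le_rfl le_rfl) (by push_cast at e ⊢; linear_combination -e)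
    obtain ⟨rfl, rfl, rfl⟩ := this
    exact absurd hP h3
  obtain _ | p := p
  swap
  · have := h.inj h1 (h.down hP le_rfl le_rfl p.le_succ) (by push_cast at e ⊢; linear_combination -e)
    omega
  have hnj : n ≤ j := by
    by_contra hlt
    exact hj' (h.down hP le_rfl (by omega) le_rfl)
  obtain rfl | hlt := hnj.eq_or_lt
  · push_cast at e
    linear_combination -e
  · have := h.inj h1 (h.down hj le_rfl (show n + 1 ≤ j by omega) le_rfl)
      (by push_cast at e ⊢; linear_combination -e)
    omega

/-- If the first missing power of `x` has the weight of a power of `y`, then the extent of the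
set along the `x`-axis is determined by its two corners. -/
theorem add_le_of_weight_eq (h : IsWeightBasis r b P) {iy jy iz kz j k N n : ℕ}
    (hyv : IsCorner (fun m n => P m n 0) iy jy) (hzv : IsCorner (fun m p => P m 0 p) iz kz)
    (hzu : ∀ m p : ℕ, IsCorner (fun m p => P m 0 p) m p → (m, p) = (iz, kz))
    (hj : P 0 j 0) (hj' : ¬ P 0 (j + 1) 0) (hk : P 0 0 k) (hk' : ¬ P 0 0 (k + 1))
    (hN : P N 0 0) (hyN : iy < N) (hzN : iz < N) (hn : P 0 n 0)
    (e : (N : ZMod r) + 1 = b * n) : iy + iz + 1 ≤ N := by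
  by_contra hlt
  have wz := h.weight_corner hzv hj hj'
  have wy := h.swap.weight_corner hyv hk hk'
  have hnj : n ≤ j := by
    by_contra hc
    exact hj' (h.down hn le_rfl (by omega) le_rfl)
  have hkz : kz < k := by
    by_contra hc
    exact hk' (h.down hzv.2.2.1 (by omega) le_rfl (by omega))
  have hzk : P iz 0 k := by
    by_contra hc
    have := corner_lt_of_notMem (fun hP hm hp => h.down hP hm le_rfl hp) hzu iz k
      (h.down hzv.1 le_rfl le_rfl (by omega)) hk hc
    omega
  obtain ⟨q, rfl⟩ : ∃ q, j = n + q := ⟨j - n, by omega⟩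
  obtain ⟨x, rfl⟩ : ∃ x, N = iz + x := ⟨N - iz, by omega⟩
  push_cast at *
  have hq : k ≤ q + kz := by
    by_contra hc
    have := h.inj (h.down hN (show x ≤ iz + x by omega) le_rfl le_rfl)
      (h.down hk le_rfl le_rfl (show q + kz + 1 ≤ k by omega))
      (by push_cast; linear_combination e - wz)
    omega
  obtain ⟨t, ht⟩ : ∃ t, q + kz = k + t := ⟨q + kz - k, by omega⟩
  have ht' : (q : ZMod r) + kz = k + t := by exact_mod_cast congrArg (Nat.cast (R := ZMod r)) ht
  obtain ⟨d, hd⟩ : ∃ d, iy + 1 = x + d := ⟨iy + 1 - x, by omega⟩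
  have hd' : (iy : ZMod r) + 1 = x + d := by
    exact_mod_cast congrArg (Nat.cast (R := ZMod r)) hd
  obtain ⟨y, hy⟩ : ∃ y, iz + x = iy + y := ⟨iz + x - iy, by omega⟩
  have hy' : (iz : ZMod r) + x = iy + y := by exact_mod_cast congrArg (Nat.cast (R := ZMod r)) hy
  have hnq : q ≤ jy := by
    by_contra hc
    have := h.inj (h.down hzk (show y ≤ iz by omega) le_rfl le_rfl)
      (h.down hj le_rfl (show n + jy + 1 ≤ n + q by omega) le_rfl)
      (by push_cast; linear_combination e - wy - hy')
    omega
  obtain ⟨u, hu⟩ : ∃ u, jy = t + u := ⟨jy - t, by omega⟩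
  have hu' : (jy : ZMod r) = t + u := by exact_mod_cast congrArg (Nat.cast (R := ZMod r)) hu
  have := h.inj (h.down hyv.1 (show d ≤ iy by omega) (show u ≤ jy by omega) le_rfl) h.zero_mem
    (by push_cast; linear_combination wy - hd' - e + wz + b * ht' - b * hu')
  omega

/-- The extent along the `x`-axis of a set with a single corner in each coordinate plane. -/
theorem mem_x_axis [NeZero r] (h : IsWeightBasis r b P) {iy jy iz kz j k : ℕ}
    (hyv : IsCorner (fun m n => P m n 0) iy jy) (hzv : IsCorner (fun m p => P m 0 p) iz kz)
    (hyu : ∀ m n : ℕ, IsCorner (fun m n => P m n 0) m n → (m, n) = (iy, jy))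
    (hzu : ∀ m p : ℕ, IsCorner (fun m p => P m 0 p) m p → (m, p) = (iz, kz))
    (hj : P 0 j 0) (hj' : ¬ P 0 (j + 1) 0) (hk : P 0 0 k) (hk' : ¬ P 0 0 (k + 1)) :
    P (iy + iz + 1) 0 0 := by
  have hex : ∃ N, ¬ P (N + 1) 0 0 := by
    refine ⟨r, fun hP => ?_⟩
    have := h.inj (h.down hP r.le_succ le_rfl le_rfl) h.zero_mem (by simp)
    exact NeZero.ne r this.1
  obtain ⟨N, hN, hN'⟩ : ∃ N, P N 0 0 ∧ ¬ P (N + 1) 0 0 := by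
    refine ⟨Nat.find hex, ?_, Nat.find_spec hex⟩
    cases hf : Nat.find hex with
    | zero => exact h.zero_mem
    | succ M =>
      by_contra hc
      have := Nat.find_min' hex hc
      omega
  have hyN : iy < N := by
    by_contra hc
    exact hN' (h.down hyv.2.1 (by omega) (by omega) le_rfl)
  have hzN : iz < N := by
    by_contra hc
    exact hN' (h.down hzv.2.1 (by omega) le_rfl (by omega))
  refine h.down hN ?_ le_rfl le_rfl
  obtain ⟨m, n, p, hP, e⟩ := h.surj ((N : ZMod r) + 1)
  obtain _ | m := m
  swap
  · have := h.inj hN (h.down hP m.le_succ le_rfl le_rfl) (by push_cast at e ⊢; linear_combination -e)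
    obtain ⟨rfl, rfl, rfl⟩ := this
    exact absurd hP hN'
  obtain _ | p := p
  · exact h.add_le_of_weight_eq hyv hzv hzu hj hj' hk hk' hN hyN hzN hP
      (by push_cast at e; linear_combination -e)
  · obtain _ | n := n
    · have := h.swap.add_le_of_weight_eq hzv hyv hyu hk hk' hj hj' hN hzN hyN hP
        (by push_cast at e ⊢; linear_combination -e)
      omega
    · exact absurd hP (h.notMem_of_pos_of_pos n.succ_pos p.succ_pos)

/-- The minimal monomials outside the set. -/
theorem cases_of_notMem [NeZero r] (h : IsWeightBasis r b P) {iy jy iz kz j k : ℕ}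
    (hyv : IsCorner (fun m n => P m n 0) iy jy) (hzv : IsCorner (fun m p => P m 0 p) iz kz)
    (hyu : ∀ m n : ℕ, IsCorner (fun m n => P m n 0) m n → (m, n) = (iy, jy))
    (hzu : ∀ m p : ℕ, IsCorner (fun m p => P m 0 p) m p → (m, p) = (iz, kz))
    (hj : P 0 j 0) (hj' : ¬ P 0 (j + 1) 0) (hk : P 0 0 k) (hk' : ¬ P 0 0 (k + 1))
    {m n p : ℕ} (hP : ¬ P m n p) :
    (1 ≤ n ∧ 1 ≤ p) ∨ iy + iz + 2 ≤ m ∨ j + 1 ≤ n ∨ k + 1 ≤ p ∨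
      (iy + 1 ≤ m ∧ jy + 1 ≤ n) ∨ (iz + 1 ≤ m ∧ kz + 1 ≤ p) := by
  have hx := h.mem_x_axis hyv hzv hyu hzu hj hj' hk hk'
  by_contra! hc
  obtain _ | p := p
  · have := corner_lt_of_notMem (fun hP hm hn => h.down hP hm hn le_rfl) hyu m n
      (h.down hx (by omega) le_rfl le_rfl) (h.down hj le_rfl (by omega) le_rfl) hP
    omega
  obtain _ | n := n
  · have := corner_lt_of_notMem (fun hP hm hp => h.down hP hm le_rfl hp) hzu m (p + 1)
      (h.down hx (by omega) le_rfl le_rfl) (h.down hk le_rfl le_rfl (by omega)) hP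
    omega
  omega

end IsWeightBasis

theorem wtN_eq {r a : ℕ} (ha : a ≤ r) (m n p : ℕ) :
    wtN r a (m, n, p) = (m : ZMod r) + a * n - a * p := by
  simp only [wtN, wtZ, toZ, Nat.cast_sub ha, Int.cast_natCast, CharP.cast_eq_zero]
  ring

theorem IsGSet.isWeightBasis {r a : ℕ} (ha : a ≤ r) {Γ : Set N3} (hΓ : IsGSet r a Γ) :
    IsWeightBasis r a (fun m n p => (m, n, p) ∈ Γ) where
  down {m n p m' n' p'} hP hm hn hp := by
    refine (hΓ.dclosed (m', n', p') (m - m', n - n', p - p') ?_).1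
    simpa [Nat.add_sub_cancel' hm, Nat.add_sub_cancel' hn, Nat.add_sub_cancel' hp] using hP
  inj hP hP' e := by
    have := hΓ.bij.injOn hP hP' (by rw [wtN_eq ha, wtN_eq ha, e])
    simpa using this
  surj c := by
    obtain ⟨⟨m, n, p⟩, hP, e⟩ := hΓ.bij.surjOn (Set.mem_univ c)
    exact ⟨m, n, p, hP, by rw [← e, wtN_eq ha]⟩

theorem IsGSet.wtG_eq {r a : ℕ} {Γ : Set N3} (hΓ : IsGSet r a Γ) {u v : N3} (hu : u ∈ Γ)
    (e : wtN r a u = wtN r a v) : wtG r a Γ v = u := by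
  have hex : ∃ w, w ∈ Γ ∧ wtN r a w = wtN r a v := ⟨u, hu, e⟩
  rw [wtG, dif_pos hex]
  exact hΓ.bij.injOn hex.choose_spec.1 hu (hex.choose_spec.2.trans e.symm)

theorem IsGSet.sG_eq {r a : ℕ} {Γ : Set N3} (hΓ : IsGSet r a Γ) {u v : N3} (hu : u ∈ Γ)
    (e : wtN r a u = wtN r a v) : sG r a Γ v = toZ v - toZ u := by
  rw [sG, hΓ.wtG_eq hu e]

/-- Every monomial can be brought into `Γ` by subtracting the four binomial exponents.
Termination is witnessed by a positive linear form taking the same value on all four. -/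
theorem exists_reduction {r a : ℕ} (har : a ≤ r) {Γ : Set N3} {C : AddSubmonoid Z3}
    {iy jy iz kz j k : ℕ} (hjy : jy < j) (hkz : kz < k)
    (wz : (iz : ZMod r) + 1 - a * (kz + 1) = a * j)
    (wy : (iy : ZMod r) + 1 - -(a : ZMod r) * (jy + 1) = -a * k)
    (mβ : (-(iz + 1 : ℤ), (j + 1 : ℤ), -(kz : ℤ)) ∈ C)
    (mγ : (-(iy + 1 : ℤ), -(jy : ℤ), (k + 1 : ℤ)) ∈ C)
    (my : ((iy + 1 : ℤ), (jy + 1 : ℤ), -(k : ℤ)) ∈ C)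
    (mz : ((iz + 1 : ℤ), -(j : ℤ), (kz + 1 : ℤ)) ∈ C)
    (hcases : ∀ {m n p : ℕ}, (m, n, p) ∉ Γ →
      (1 ≤ n ∧ 1 ≤ p) ∨ iy + iz + 2 ≤ m ∨ j + 1 ≤ n ∨ k + 1 ≤ p ∨
        (iy + 1 ≤ m ∧ jy + 1 ≤ n) ∨ (iz + 1 ≤ m ∧ kz + 1 ≤ p))
    (m n p : ℕ) :
    ∃ u ∈ Γ, wtN r a u = wtN r a (m, n, p) ∧ toZ (m, n, p) - toZ u ∈ C := by
  obtain ⟨j, rfl⟩ : ∃ j', j = jy + 1 + j' := ⟨j - jy - 1, by omega⟩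
  obtain ⟨k, rfl⟩ : ∃ k', k = kz + 1 + k' := ⟨k - kz - 1, by omega⟩
  set φ : ℕ → ℕ → ℕ → ℕ := fun m n p =>
    ((2 * kz + 1) * (j + 1) + (k + 1) * (2 * (jy + 1 + j) + 1)) * m +
      ((iz + 1) * (2 * (kz + 1 + k) + 1) + (iy + 1) * (2 * kz + 1)) * n +
      ((iy + 1) * (2 * (jy + 1 + j) + 1) + (iz + 1) * (2 * jy + 1)) * p with hφ
  have step : ∀ (m n p m' n' p' : ℕ) (d : Z3), φ m' n' p' < φ m n p → d ∈ C → wtZ r a d = 0 →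
      toZ (m, n, p) = toZ (m', n', p') + d →
      (∀ x y z : ℕ, φ x y z < φ m n p →
        ∃ u ∈ Γ, wtN r a u = wtN r a (x, y, z) ∧ toZ (x, y, z) - toZ u ∈ C) →
      ∃ u ∈ Γ, wtN r a u = wtN r a (m, n, p) ∧ toZ (m, n, p) - toZ u ∈ C := by
    intro m n p m' n' p' d hlt hd hwd hv ih
    obtain ⟨u, hu, e, hmem⟩ := ih m' n' p' hlt
    refine ⟨u, hu, ?_, ?_⟩
    · have : wtN r a (m, n, p) = wtN r a (m', n', p') + wtZ r a d := by
        rw [wtN, wtN, hv]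
        simp only [wtZ, Prod.fst_add, Prod.snd_add]
        push_cast
        ring
      rw [this, hwd, add_zero, e]
    · have : toZ (m, n, p) - toZ u = (toZ (m', n', p') - toZ u) + d := by
        rw [hv]
        abel
      rw [this]
      exact C.add_mem hmem hd
  have hra : ((r - a : ℕ) : ZMod r) = -a := by simp [Nat.cast_sub har]
  induction hs : φ m n p using Nat.strong_induction_on generalizing m n p with
  | _ s ih =>
    subst hs
    have ih' : ∀ x y z : ℕ, φ x y z < φ m n p →
        ∃ u ∈ Γ, wtN r a u = wtN r a (x, y, z) ∧ toZ (x, y, z) - toZ u ∈ C :=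
      fun x y z hlt => ih _ hlt x y z rfl
    by_cases hmem : (m, n, p) ∈ Γ
    · exact ⟨_, hmem, rfl, by simp⟩
    push_cast at *
    rcases hcases hmem with ⟨hn, hp⟩ | hm | hn | hp | ⟨hm, hn⟩ | ⟨hm, hp⟩
    · obtain ⟨n, rfl⟩ := Nat.exists_eq_add_of_le hn
      obtain ⟨p, rfl⟩ := Nat.exists_eq_add_of_le hp
      refine step _ _ _ m n p _ ?_ (C.add_mem mβ mz) ?_ ?_ ih'
      · simp only [hφ]
        nlinarith
      · simp only [wtZ, hra, Prod.mk_add_mk]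
        push_cast
        ring
      · ext <;> simp [toZ] <;> ring
    · obtain ⟨m, rfl⟩ := Nat.exists_eq_add_of_le hm
      refine step _ _ _ m (n + j) (p + k) _ ?_ (C.add_mem my mz) ?_ ?_ ih'
      · simp only [hφ]
        nlinarith
      · simp only [wtZ, hra, Prod.mk_add_mk]
        push_cast
        linear_combination wy + wz
      · ext <;> simp [toZ] <;> ring
    · obtain ⟨n, rfl⟩ := Nat.exists_eq_add_of_le hn
      refine step _ _ _ (m + iz + 1) n (p + kz) _ ?_ mβ ?_ ?_ ih'
      · simp only [hφ]
        nlinarith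
      · simp only [wtZ, hra]
        push_cast
        linear_combination -wz
      · ext <;> simp [toZ] <;> ring
    · obtain ⟨p, rfl⟩ := Nat.exists_eq_add_of_le hp
      refine step _ _ _ (m + iy + 1) (n + jy) p _ ?_ mγ ?_ ?_ ih'
      · simp only [hφ]
        nlinarith
      · simp only [wtZ, hra]
        push_cast
        linear_combination -wy
      · ext <;> simp [toZ] <;> ring
    · obtain ⟨m, rfl⟩ := Nat.exists_eq_add_of_le hm
      obtain ⟨n, rfl⟩ := Nat.exists_eq_add_of_le hn
      refine step _ _ _ m n (p + (kz + 1 + k)) _ ?_ my ?_ ?_ ih'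
      · simp only [hφ]
        nlinarith
      · simp only [wtZ, hra]
        push_cast
        linear_combination wy
      · ext <;> simp [toZ] <;> ring
    · obtain ⟨m, rfl⟩ := Nat.exists_eq_add_of_le hm
      obtain ⟨p, rfl⟩ := Nat.exists_eq_add_of_le hp
      refine step _ _ _ m (n + (jy + 1 + j)) p _ ?_ mz ?_ ?_ ih'
      · simp only [hφ]
        nlinarith
      · simp only [wtZ, hra]
        push_cast
        linear_combination wz
      · ext <;> simp [toZ] <;> ring

/-- For a `G`-set with two valleys, `S(Γ)` is generated by
`s_Γ(β), s_Γ(γ), s_Γ(δ_y), s_Γ(δ_z)`, with the relation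
`s_Γ(β) + s_Γ(δ_z) = s_Γ(γ) + s_Γ(δ_y) = (0,1,1)`. -/
theorem stmt6 (r a : ℕ) (hra : Nat.Coprime r a) (ha2 : 2 ≤ a) (halt : a < r - a) (Γ : Set N3) (hΓ : IsGSet r a Γ)
    (iy jy iz kz : ℕ)
    (hyv : IsYValley Γ iy jy) (hzv : IsZValley Γ iz kz)
    (hyu : ∀ m n : ℕ, IsYValley Γ m n → (m, n) = (iy, jy))
    (hzu : ∀ m n : ℕ, IsZValley Γ m n → (m, n) = (iz, kz))
    (j k : ℕ)
    (hj : (0, j, 0) ∈ Γ ∧ (0, j + 1, 0) ∉ Γ)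
    (hk : (0, 0, k) ∈ Γ ∧ (0, 0, k + 1) ∉ Γ) :
    SMon r a Γ =
      AddSubmonoid.closure
        {sG r a Γ (0, j + 1, 0), sG r a Γ (0, 0, k + 1),
          sG r a Γ (iy + 1, jy + 1, 0), sG r a Γ (iz + 1, 0, kz + 1)} ∧
    sG r a Γ (0, j + 1, 0) + sG r a Γ (iz + 1, 0, kz + 1) = ((0 : ℤ), (1 : ℤ), (1 : ℤ)) ∧
    sG r a Γ (0, 0, k + 1) + sG r a Γ (iy + 1, jy + 1, 0) = ((0 : ℤ), (1 : ℤ), (1 : ℤ)) := by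
  have har : a ≤ r := by omega
  have : NeZero r := ⟨by omega⟩
  have hB := hΓ.isWeightBasis har
  have wz := hB.weight_corner hzv hj.1 hj.2
  have wy := hB.swap.weight_corner hyv hk.1 hk.2
  have hjy : jy < j := by
    by_contra hc
    exact hj.2 (hB.down hyv.2.2.1 (by omega) (by omega) le_rfl)
  have hkz : kz < k := by
    by_contra hc
    exact hk.2 (hB.down hzv.2.2.1 (by omega) le_rfl (by omega))
  have sβ : sG r a Γ (0, j + 1, 0) = (-(iz + 1 : ℤ), (j + 1 : ℤ), -(kz : ℤ)) := by
    rw [hΓ.sG_eq hzv.2.1 (by rw [wtN_eq har, wtN_eq har]; push_cast; linear_combination wz)]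
    simp [toZ]
  have sγ : sG r a Γ (0, 0, k + 1) = (-(iy + 1 : ℤ), -(jy : ℤ), (k + 1 : ℤ)) := by
    rw [hΓ.sG_eq hyv.2.1 (by rw [wtN_eq har, wtN_eq har]; push_cast; linear_combination wy)]
    simp [toZ]
  have sy : sG r a Γ (iy + 1, jy + 1, 0) = ((iy + 1 : ℤ), (jy + 1 : ℤ), -(k : ℤ)) := by
    rw [hΓ.sG_eq hk.1 (by rw [wtN_eq har, wtN_eq har]; push_cast; linear_combination -wy)]
    simp [toZ]
  have sz : sG r a Γ (iz + 1, 0, kz + 1) = ((iz + 1 : ℤ), -(j : ℤ), (kz + 1 : ℤ)) := by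
    rw [hΓ.sG_eq hj.1 (by rw [wtN_eq har, wtN_eq har]; push_cast; linear_combination -wz)]
    simp [toZ]
  refine ⟨le_antisymm ?_ ?_, ?_, ?_⟩
  · refine AddSubmonoid.closure_le.2 ?_
    rintro _ ⟨v, rfl⟩
    set C := AddSubmonoid.closure
        {sG r a Γ (0, j + 1, 0), sG r a Γ (0, 0, k + 1),
          sG r a Γ (iy + 1, jy + 1, 0), sG r a Γ (iz + 1, 0, kz + 1)} with hC
    have mβ : sG r a Γ (0, j + 1, 0) ∈ C := AddSubmonoid.subset_closure (by simp)
    have mγ : sG r a Γ (0, 0, k + 1) ∈ C := AddSubmonoid.subset_closure (by simp)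
    have my : sG r a Γ (iy + 1, jy + 1, 0) ∈ C := AddSubmonoid.subset_closure (by simp)
    have mz : sG r a Γ (iz + 1, 0, kz + 1) ∈ C := AddSubmonoid.subset_closure (by simp)
    rw [sβ] at mβ
    rw [sγ] at mγ
    rw [sy] at my
    rw [sz] at mz
    obtain ⟨m, n, p⟩ := v
    obtain ⟨u, hu, e, hd⟩ := exists_reduction har hjy hkz wz wy mβ mγ my mz
      (fun h => hB.cases_of_notMem hyv hzv hyu hzu hj.1 hj.2 hk.1 hk.2 h) m n p
    rw [hΓ.sG_eq hu e]
    exact hd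
  · refine AddSubmonoid.closure_mono ?_
    rintro _ (rfl | rfl | rfl | rfl) <;> exact ⟨_, rfl⟩
  · rw [sβ, sz]
    ext <;> simp
  · rw [sγ, sy]
    ext <;> simp

end GH
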